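/- Consider online bin packing with bins of capacity k restricted to instances in which at most r items fit into a bin (every r+1 items of the input have total size exceeding k), where r is an integer with 2 ≤ r ≤ k and r divides k. Fix a constant c < 1. For any α with 0 < α ≤ c/r, every online algorithm with frequency predictions whose consistency on such instances is at most 1+α has robustness at least (1−c)·r/2 on such instances. -/

import Mathlib

open scoped BigOperators Classical

namespace BinPackingWithPredictions

/-! ## Offline bin packing with integral sizes -/

/-- `L` is a packing of the multiset `S` of item sizes into bins of capacity `k`:
the bins (each a multiset of item sizes) partition `S`, and each bin has total size `≤ k`. -/
def IsPacking (k : ℕ) (S : Multiset ℕ) (L : Multiset (Multiset ℕ)) : Prop :=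
  L.sum = S ∧ ∀ B ∈ L, B.sum ≤ k

/-- `OPT k S` is the minimum number of bins of capacity `k` needed to pack `S`. -/
noncomputable def OPT (k : ℕ) (S : Multiset ℕ) : ℕ :=
  sInf {N | ∃ L, IsPacking k S L ∧ L.card = N}

/-- A valid input sequence: every item size is an integer in `[1,k]`. -/
def ValidSeq (k : ℕ) (σ : List ℕ) : Prop := ∀ a ∈ σ, 1 ≤ a ∧ a ≤ k

/-- The frequency of size `x` in `σ`. -/
noncomputable def freq (σ : List ℕ) (x : ℕ) : ℝ := (σ.count x : ℝ) / (σ.length : ℝ)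

/-- A valid prediction vector: `f' x ∈ [0,1]` for every size `x ∈ [1,k]`. -/
def ValidPred (k : ℕ) (f' : ℕ → ℝ) : Prop := ∀ x ∈ Finset.Icc 1 k, 0 ≤ f' x ∧ f' x ≤ 1

/-- The prediction error: the L1 distance between the true frequencies and the prediction. -/
noncomputable def errOf (k : ℕ) (σ : List ℕ) (f' : ℕ → ℝ) : ℝ :=
  ∑ x ∈ Finset.Icc 1 k, |freq σ x - f' x|

/-- The number `τ_k` of bin types for capacity `k`: a bin type is determined by the
multiset of its placeholders (integers in `[1,k]` of total at most `k`). -/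
noncomputable def numBinTypes (k : ℕ) : ℕ :=
  Set.ncard {T : Multiset ℕ | (∀ s ∈ T, 1 ≤ s ∧ s ≤ k) ∧ T.sum ≤ k}

/-- The input class in which at most `r` items fit into a bin: every `r+1` items
of the input have total size exceeding `k`. -/
def AtMostPerBin (k r : ℕ) (σ : List ℕ) : Prop :=
  ∀ S : Multiset ℕ, S ≤ ↑σ → S.card = r + 1 → k < S.sum

/-! ## FirstFit -/

/-- One step of FirstFit: place an item of size `x` into the first bin (the bins are listed
with their current loads, in the order they were opened) where it fits; open a new bin
if it fits nowhere. -/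
def ffStep (k : ℕ) : List ℕ → ℕ → List ℕ
  | [], x => [x]
  | b :: rest, x => if b + x ≤ k then (b + x) :: rest else b :: ffStep k rest x

/-- The number of bins FirstFit opens on the sequence `σ` with bins of capacity `k`. -/
def FF (k : ℕ) (σ : List ℕ) : ℕ := (σ.foldl (ffStep k) []).length

/-! ## ProfilePacking -/

/-- The profile multiset: `⌈f' x * m⌉` items of size `x` for each `x ∈ [1,k]`. -/
noncomputable def profile (k m : ℕ) (f' : ℕ → ℝ) : Multiset ℕ :=
  ∑ x ∈ Finset.Icc 1 k, Multiset.replicate ⌈f' x * (m : ℝ)⌉₊ x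

/-- The number of placeholders of bin `b` of group `g` that are occupied by items of size `x`
among the first `i` (non-special) items, under the placeholder assignment `assign`. -/
def occupied (σ : List ℕ) (assign : ℕ → Option (ℕ × ℕ)) (i g b x : ℕ) : ℕ :=
  ((Finset.range i).filter fun j => assign j = some (g, b) ∧ σ.getD j 0 = x).card

/-- After the first `i` items there is a free placeholder of size `x` in one of the
first `G` profile groups. -/
def hasFree (types : List (Multiset ℕ)) (σ : List ℕ) (assign : ℕ → Option (ℕ × ℕ))
    (i G x : ℕ) : Prop :=
  ∃ g < G, ∃ b < types.length, occupied σ assign i g b x < (types.getD b 0).count x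

/-- The number of profile groups (virtually) opened by ProfilePacking after serving the
first `i` items: one group is opened at the start, and a new group is opened exactly when a
non-special item finds no free placeholder of its size. -/
noncomputable def groups (types : List (Multiset ℕ)) (σ : List ℕ) (f' : ℕ → ℝ)
    (assign : ℕ → Option (ℕ × ℕ)) : ℕ → ℕ
  | 0 => 1
  | i + 1 =>
      if f' (σ.getD i 0) = 0 ∨
          hasFree types σ assign i (groups types σ f' assign i) (σ.getD i 0) then
        groups types σ f' assign i
      else groups types σ f' assign i + 1

/-- `types`, `assign` describe a (nondeterministic) run of ProfilePacking with parameter `m`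
and prediction `f'` on the input `σ`:
`types` lists the bins of an optimal packing of the profile (the common type structure of
every profile group); every non-special item (and nothing else) is assigned a placeholder of
its own size, in a bin `b` of a group `g`; a group beyond the opened ones is used only when
no free placeholder of the item's size exists, in which case the new group is the next one. -/
def PPValid (k m : ℕ) (f' : ℕ → ℝ) (σ : List ℕ)
    (types : List (Multiset ℕ)) (assign : ℕ → Option (ℕ × ℕ)) : Prop :=
  IsPacking k (profile k m f') (↑types) ∧
  types.length = OPT k (profile k m f') ∧
  (∀ i, (assign i).isSome ↔ (i < σ.length ∧ f' (σ.getD i 0) ≠ 0)) ∧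
  ∀ i g b, assign i = some (g, b) →
    b < types.length ∧
    occupied σ assign i g b (σ.getD i 0) < (types.getD b 0).count (σ.getD i 0) ∧
    g < groups types σ f' assign (i + 1) ∧
    (¬ hasFree types σ assign i (groups types σ f' assign i) (σ.getD i 0) →
      g = groups types σ f' assign i)

/-- The special items of `σ`: those whose size has predicted frequency `0`. -/
noncomputable def specials (f' : ℕ → ℝ) (σ : List ℕ) : List ℕ :=
  σ.filter fun a => decide (f' a = 0)

/-- The cost of a run of ProfilePacking: bins are opened lazily, so only the
placeholder bins that actually receive an item are counted, plus the bins that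
FirstFit opens for the special items (packed separately). -/
noncomputable def PPcost (k : ℕ) (f' : ℕ → ℝ) (σ : List ℕ)
    (assign : ℕ → Option (ℕ × ℕ)) : ℕ :=
  Set.ncard {gb : ℕ × ℕ | ∃ i, assign i = some gb} + FF k (specials f' σ)


/-! ## Online algorithms (with and without frequency predictions) -/

/-- An online algorithm with frequency predictions is a function that, given the prediction
vector and the sequence of items revealed so far (ending with the current item), returns the
index of the bin receiving the current item.  `pAssign A f' σ i` is the bin receiving the
`i`-th item of `σ`. -/
def pAssign (A : (ℕ → ℝ) → List ℕ → ℕ) (f' : ℕ → ℝ) (σ : List ℕ) (i : ℕ) : ℕ :=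
  A f' (σ.take (i + 1))

/-- The final load of bin `b`. -/
def pLoad (A : (ℕ → ℝ) → List ℕ → ℕ) (f' : ℕ → ℝ) (σ : List ℕ) (b : ℕ) : ℕ :=
  ∑ i ∈ Finset.range σ.length, if pAssign A f' σ i = b then σ.getD i 0 else 0

/-- The algorithm never exceeds the bin capacity `k` on valid inputs. -/
def PFeasible (k : ℕ) (A : (ℕ → ℝ) → List ℕ → ℕ) : Prop :=
  ∀ f' σ, ValidPred k f' → ValidSeq k σ → ∀ b, pLoad A f' σ b ≤ k

/-- The number of bins the online algorithm `A` uses on `σ` with prediction `f'`. -/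
def pCost (A : (ℕ → ℝ) → List ℕ → ℕ) (f' : ℕ → ℝ) (σ : List ℕ) : ℕ :=
  ((Finset.range σ.length).image (pAssign A f' σ)).card

/-- An online algorithm without predictions, as a map from the revealed prefix
(ending with the current item) to the index of the bin receiving the current item. -/
def npAssign (A : List ℕ → ℕ) (σ : List ℕ) (i : ℕ) : ℕ := A (σ.take (i + 1))

def npLoad (A : List ℕ → ℕ) (σ : List ℕ) (b : ℕ) : ℕ :=
  ∑ i ∈ Finset.range σ.length, if npAssign A σ i = b then σ.getD i 0 else 0

def NPFeasible (k : ℕ) (A : List ℕ → ℕ) : Prop :=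
  ∀ σ, ValidSeq k σ → ∀ b, npLoad A σ b ≤ k

def npCost (A : List ℕ → ℕ) (σ : List ℕ) : ℕ :=
  ((Finset.range σ.length).image (npAssign A σ)).card




lemma sub_load {k : ℕ} {A : (ℕ → ℝ) → List ℕ → ℕ} (hfeas : PFeasible k A)
    {f' : ℕ → ℝ} {σ : List ℕ} (hf : ValidPred k f') (hσ : ValidSeq k σ) (b : ℕ)
    (T : Finset ℕ) (hT : ∀ i ∈ T, i < σ.length ∧ pAssign A f' σ i = b) :
    ∑ i ∈ T, σ.getD i 0 ≤ k := by
  refine le_trans ?_ (hfeas f' σ hf hσ b)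
  unfold pLoad
  calc ∑ i ∈ T, σ.getD i 0 = ∑ i ∈ T, (if pAssign A f' σ i = b then σ.getD i 0 else 0) := by
        apply Finset.sum_congr rfl
        intro i hi
        rw [if_pos (hT i hi).2]
    _ ≤ _ := by
        apply Finset.sum_le_sum_of_subset
        intro i hi
        exact Finset.mem_range.2 (hT i hi).1

lemma exists_packing {k : ℕ} {σ : List ℕ} (hσ : ValidSeq k σ) :
    ∃ L, IsPacking k (↑σ) L := by
  refine ⟨(↑σ : Multiset ℕ).map (fun a => {a}), ?_, ?_⟩
  · exact Multiset.sum_map_singleton _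
  · intro B hB
    obtain ⟨a, ha, rfl⟩ := Multiset.mem_map.1 hB
    simpa using (hσ a (by simpa using ha)).2

lemma card_sum_le (r : ℕ) (L : Multiset (Multiset ℕ)) (h : ∀ B ∈ L, B.card ≤ r) :
    L.sum.card ≤ r * L.card := by
  induction L using Multiset.induction_on with
  | empty => simp
  | cons B L ih =>
    have h1 := h B (Multiset.mem_cons_self _ _)
    have h2 := ih (fun B' hB' => h B' (Multiset.mem_cons_of_mem hB'))
    simp only [Multiset.sum_cons, Multiset.card_add, Multiset.card_cons]
    nlinarith

lemma len_le_opt {k r : ℕ} {σ : List ℕ} (hσ : ValidSeq k σ) (hr : AtMostPerBin k r σ) :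
    σ.length ≤ r * OPT k ↑σ := by
  obtain ⟨L0, hL0⟩ := exists_packing hσ
  have hne : {N | ∃ L, IsPacking k (↑σ) L ∧ L.card = N}.Nonempty := ⟨_, L0, hL0, rfl⟩
  obtain ⟨L, hL, hc⟩ := Nat.sInf_mem hne
  unfold OPT
  rw [← hc]
  have := card_sum_le r L ?_
  · rw [hL.1] at this
    simpa using this
  · intro B hB
    by_contra hlt
    push Not at hlt
    obtain ⟨S, hS, hcard⟩ : ∃ S, S ≤ B ∧ S.card = r + 1 := by
      refine ⟨↑(B.toList.take (r + 1)), ?_, ?_⟩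
      · conv_rhs => rw [← Multiset.coe_toList B]
        exact Multiset.coe_le.2 (List.take_sublist _ _).subperm
      · rw [Multiset.coe_card, List.length_take, Multiset.length_toList]
        omega
    have hBs : B ≤ (↑σ : Multiset ℕ) := by
      rw [← hL.1]; exact Multiset.single_le_sum (fun _ _ => zero_le) B hB
    have h1 := hr S (hS.trans hBs) hcard
    have h2 := hL.2 B hB
    have h3 : S.sum ≤ B.sum := by
      obtain ⟨u, rfl⟩ := Multiset.le_iff_exists_add.1 hS
      simp
    omega

lemma opt_le {k : ℕ} {S : Multiset ℕ} {L : Multiset (Multiset ℕ)} (h : IsPacking k S L) :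
    OPT k S ≤ L.card := Nat.sInf_le ⟨L, h, rfl⟩

lemma atMost_of_ge {k r s : ℕ} (hs : 0 < s) (hk : k = r * s) {σ : List ℕ}
    (h : ∀ a ∈ σ, s ≤ a) : AtMostPerBin k r σ := by
  intro S hS hc
  have : S.card • s ≤ S.sum := Multiset.card_nsmul_le_sum (fun x hx => h x (by
    simpa using Multiset.mem_of_le hS hx))
  rw [hc, smul_eq_mul, add_mul] at this
  omega

lemma pCost_le (A : (ℕ → ℝ) → List ℕ → ℕ) (f' : ℕ → ℝ) (σ : List ℕ) :
    pCost A f' σ ≤ σ.length := by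
  unfold pCost
  exact Finset.card_image_le.trans (by simp)

lemma ratio_le {k r : ℕ} {A : (ℕ → ℝ) → List ℕ → ℕ} {f' : ℕ → ℝ} {σ : List ℕ}
    (hσ : ValidSeq k σ) (hr : AtMostPerBin k r σ) :
    (pCost A f' σ : ℝ) / (OPT k ↑σ : ℝ) ≤ r := by
  apply div_le_of_le_mul₀ (by positivity) (by positivity)
  exact_mod_cast (pCost_le A f' σ).trans (len_le_opt hσ hr)

lemma freq_valid (k : ℕ) (σ : List ℕ) : ValidPred k (freq σ) := by
  intro x _
  unfold freq
  refine ⟨by positivity, div_le_one_of_le₀ ?_ (by positivity)⟩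
  exact_mod_cast List.count_le_length

/-- small items then large items -/
def seqA (n s t : ℕ) : List ℕ := List.replicate n s ++ List.replicate n t

lemma seqA_len (n s t : ℕ) : (seqA n s t).length = 2 * n := by
  simp [seqA]; omega

lemma seqA_small (n s t i : ℕ) (h : i < n) : (seqA n s t).getD i 0 = s := by
  simp [seqA, List.getElem?_append, h]

lemma seqA_large (n s t i : ℕ) (h : n ≤ i) (h2 : i < 2 * n) : (seqA n s t).getD i 0 = t := by
  have h1 : ¬ i < n := by omega
  have h3 : i - n < n := by omega
  simp [seqA, List.getElem?_append, h1, h3]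

lemma seqA_take (n s t t' i : ℕ) (h : i < n) :
    (seqA n s t).take (i + 1) = (seqA n s t').take (i + 1) := by
  have : i + 1 - n = 0 := by omega
  simp [seqA, List.take_append, this]

lemma seqA_mem {n s t a : ℕ} (h : a ∈ seqA n s t) : a = s ∨ a = t := by
  simp [seqA, List.mem_replicate] at h
  tauto

lemma core {k r s n : ℕ} (hr2 : 2 ≤ r) (hs : 0 < s) (hk : k = r * s)
    {A : (ℕ → ℝ) → List ℕ → ℕ} (hfeas : PFeasible k A)
    {f' : ℕ → ℝ} (hf : ValidPred k f') :
    n + r * n ≤ r * pCost A f' (seqA n s (k - s)) + pCost A f' (seqA n s s) := by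
  have h2s : 2 * s ≤ k := by rw [hk]; exact Nat.mul_le_mul_right _ hr2
  have hv : ∀ t, s ≤ t → t ≤ k → ValidSeq k (seqA n s t) := by
    intro t h1 h2 a ha
    rcases seqA_mem ha with rfl | rfl <;> omega
  have hvA := hv (k - s) (by omega) (by omega)
  set g := pAssign A f' (seqA n s (k - s)) with hg
  -- general fiber bound
  have hfib : ∀ b (T : Finset ℕ), (∀ i ∈ T, i < 2 * n ∧ g i = b) → T.card ≤ r := by
    intro b T hT
    have := sub_load hfeas hf hvA b T (fun i hi => by
      rw [seqA_len]; exact hT i hi)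
    have h2 : T.card • s ≤ ∑ i ∈ T, (seqA n s (k - s)).getD i 0 := by
      apply Finset.card_nsmul_le_sum
      intro i hi
      rcases lt_or_ge i n with h | h
      · rw [seqA_small _ _ _ _ h]
      · rw [seqA_large _ _ _ _ h (hT i hi).1]; omega
    rw [smul_eq_mul] at h2
    have h3 : T.card * s ≤ r * s := by omega
    exact Nat.le_of_mul_le_mul_right h3 hs
  have hC : pCost A f' (seqA n s (k - s)) = ((Finset.range (2 * n)).image g).card := by
    unfold pCost; rw [seqA_len]
  rcases Nat.lt_or_ge r 3 with hr3 | hr3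
  · have hr : r = 2 := by omega
    have hks : k - s = s := by rw [hk, hr]; omega
    have h1 : (Finset.range (2 * n)).card ≤ r * ((Finset.range (2 * n)).image g).card := by
      apply Finset.card_le_mul_card_image
      intro b _
      apply hfib b
      intro i hi
      simpa using hi
    rw [← hC, Finset.card_range] at h1
    rw [hks] at h1 ⊢
    subst hr
    omega
  · have h3s : 3 * s ≤ k := by rw [hk]; exact Nat.mul_le_mul_right _ hr3
    set Lg := (Finset.Ico n (2 * n)).image g with hLg
    set S := (Finset.range n).image g with hS
    have hinj : Set.InjOn g (Finset.Ico n (2 * n)) := by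
      intro i hi j hj hij
      by_contra hne
      simp only [Finset.coe_Ico, Set.mem_Ico] at hi hj
      have := sub_load hfeas hf hvA (g j) {i, j} (by
        intro x hx
        rw [seqA_len]
        simp only [Finset.mem_insert, Finset.mem_singleton] at hx
        rcases hx with rfl | rfl
        · exact ⟨hi.2, hij⟩
        · exact ⟨hj.2, rfl⟩)
      rw [Finset.sum_pair hne, seqA_large _ _ _ _ hi.1 hi.2, seqA_large _ _ _ _ hj.1 hj.2] at this
      omega
    have hLc : Lg.card = n := by
      rw [hLg, Finset.card_image_of_injOn hinj]; simp; omega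
    have hun : (Finset.range (2 * n)).image g = S ∪ Lg := by
      rw [hS, hLg, ← Finset.image_union]
      congr 1
      ext x; simp; omega
    have hcu : (S ∪ Lg).card = n + (S \ Lg).card := by
      rw [← Finset.sdiff_union_self_eq_union, Finset.card_union_of_disjoint Finset.sdiff_disjoint, hLc]
      omega
    have hn : n = ∑ b ∈ S, ((Finset.range n).filter (fun i => g i = b)).card := by
      conv_lhs => rw [← Finset.card_range n]
      exact Finset.card_eq_sum_card_image g _
    have hsplit : S = (S \ Lg) ∪ (S ∩ Lg) := (Finset.sdiff_union_inter S Lg).symm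
    have h1 : ∑ b ∈ S \ Lg, ((Finset.range n).filter (fun i => g i = b)).card
        ≤ (S \ Lg).card • r := by
      apply Finset.sum_le_card_nsmul
      intro b _
      apply hfib b
      intro i hi
      simp at hi
      exact ⟨by omega, hi.2⟩
    have h2 : ∑ b ∈ S ∩ Lg, ((Finset.range n).filter (fun i => g i = b)).card
        ≤ (S ∩ Lg).card • 1 := by
      apply Finset.sum_le_card_nsmul
      intro b hb
      rw [Finset.card_le_one]
      intro i hi j hj
      by_contra hne
      simp only [Finset.mem_filter, Finset.mem_range] at hi hj
      obtain ⟨l, hl, hgl⟩ := Finset.mem_image.1 (Finset.mem_inter.1 hb).2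
      simp only [Finset.mem_Ico] at hl
      have := sub_load hfeas hf hvA b {i, j, l} (by
        intro x hx
        rw [seqA_len]
        simp only [Finset.mem_insert, Finset.mem_singleton] at hx
        rcases hx with rfl | rfl | rfl
        · exact ⟨by omega, hi.2⟩
        · exact ⟨by omega, hj.2⟩
        · exact ⟨hl.2, hgl⟩)
      rw [Finset.sum_insert (by
          simp only [Finset.mem_insert, Finset.mem_singleton]; omega),
        Finset.sum_pair (by omega), seqA_small _ _ _ _ hi.1, seqA_small _ _ _ _ hj.1,
        seqA_large _ _ _ _ hl.1 hl.2] at this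
      omega
    have h3 : n ≤ (S \ Lg).card * r + (S ∩ Lg).card := by
      have h4 := Finset.sum_union (f := fun b => ((Finset.range n).filter (fun i => g i = b)).card)
        (Finset.disjoint_sdiff_inter S Lg)
      rw [Finset.sdiff_union_inter, ← hn] at h4
      simp only [smul_eq_mul, mul_one] at h1 h2
      omega
    have h4 : S.card ≤ pCost A f' (seqA n s s) := by
      unfold pCost
      rw [seqA_len]
      apply Finset.card_le_card
      intro b hb
      obtain ⟨i, hi, rfl⟩ := Finset.mem_image.1 hb
      have hi' := Finset.mem_range.1 hi
      refine Finset.mem_image.2 ⟨i, Finset.mem_range.2 (by omega), ?_⟩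
      rw [hg]
      unfold pAssign
      rw [seqA_take n s s (k - s) i hi']
    have h5 : (S ∩ Lg).card ≤ S.card := Finset.card_le_card Finset.inter_subset_left
    rw [hC, hun, hcu, mul_add]
    nlinarith

lemma opt_seqA {k n s : ℕ} (hsk : s ≤ k) : OPT k ↑(seqA n s (k - s)) ≤ n := by
  have := opt_le (k := k) (S := ↑(seqA n s (k - s))) (L := Multiset.replicate n {s, k - s}) ?_
  · simpa using this
  · constructor
    · rw [Multiset.sum_replicate]
      have : ({s, k - s} : Multiset ℕ) = {s} + {k - s} := rfl
      rw [this, nsmul_add, Multiset.nsmul_singleton, Multiset.nsmul_singleton]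
      rw [seqA, ← Multiset.coe_add, Multiset.coe_replicate, Multiset.coe_replicate]
    · intro B hB
      rw [Multiset.eq_of_mem_replicate hB]
      simp; omega

lemma opt_seqB {k r j s : ℕ} (hk : k = r * s) : OPT k ↑(seqA (r * j) s s) ≤ 2 * j := by
  have := opt_le (k := k) (S := ↑(seqA (r * j) s s))
    (L := Multiset.replicate (2 * j) (Multiset.replicate r s)) ?_
  · simpa using this
  · constructor
    · rw [Multiset.sum_replicate, Multiset.nsmul_replicate]
      have : seqA (r * j) s s = List.replicate (2 * j * r) s := by
        rw [seqA, List.replicate_append_replicate]; congr 1; ring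
      rw [this, Multiset.coe_replicate]
    · intro B hB
      rw [Multiset.eq_of_mem_replicate hB]
      simp [hk]

/-- Consider online bin packing with bins of capacity `k` restricted to
instances in which at most `r` items fit into a bin, where `2 ≤ r ≤ k` and `r` divides `k`.
Fix a constant `c < 1`.  For any `α` with `0 < α ≤ c/r`, every online algorithm with
frequency predictions whose consistency on such instances is at most `1+α` has robustness
at least `(1−c)·r/2` on such instances. -/
theorem consistency_robustness_tradeoff_consolidation
    (k : ℕ) (r : ℕ) (hr2 : 2 ≤ r) (hrk : r ≤ k) (hdvd : r ∣ k)
    (c : ℝ) (hc : c < 1)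
    (α : ℝ) (hα0 : 0 < α) (hα : α ≤ c / r)
    (A : (ℕ → ℝ) → List ℕ → ℕ) (hfeas : PFeasible k A)
    (hcons : Filter.limsup (fun n : ℕ =>
        sSup {ρ : ℝ | ∃ σ : List ℕ, σ.length = n ∧ ValidSeq k σ ∧ AtMostPerBin k r σ ∧
          ρ = (pCost A (freq σ) σ : ℝ) / (OPT k ↑σ : ℝ)}) Filter.atTop ≤ 1 + α) :
    (1 - c) * r / 2 ≤ Filter.limsup (fun n : ℕ =>
        sSup {ρ : ℝ | ∃ (σ : List ℕ) (f' : ℕ → ℝ), σ.length = n ∧ ValidSeq k σ ∧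
          AtMostPerBin k r σ ∧ ValidPred k f' ∧
          ρ = (pCost A f' σ : ℝ) / (OPT k ↑σ : ℝ)}) Filter.atTop := by
  obtain ⟨s, hk⟩ := hdvd
  have hs : 0 < s := by
    rcases Nat.eq_zero_or_pos s with h | h
    · subst h; omega
    · exact h
  have h2s : 2 * s ≤ k := by rw [hk]; exact Nat.mul_le_mul_right _ hr2
  have hrpos : (0 : ℝ) < r := by exact_mod_cast (by omega : 0 < r)
  have hαr : α * r ≤ c := (le_div_iff₀ hrpos).1 hα
  set u : ℕ → ℝ := (fun n : ℕ =>
        sSup {ρ : ℝ | ∃ σ : List ℕ, σ.length = n ∧ ValidSeq k σ ∧ AtMostPerBin k r σ ∧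
          ρ = (pCost A (freq σ) σ : ℝ) / (OPT k ↑σ : ℝ)}) with hu
  set v : ℕ → ℝ := (fun n : ℕ =>
        sSup {ρ : ℝ | ∃ (σ : List ℕ) (f' : ℕ → ℝ), σ.length = n ∧ ValidSeq k σ ∧
          AtMostPerBin k r σ ∧ ValidPred k f' ∧
          ρ = (pCost A f' σ : ℝ) / (OPT k ↑σ : ℝ)}) with hv
  have hub : Filter.IsBoundedUnder (· ≤ ·) Filter.atTop u := by
    refine Filter.isBoundedUnder_of ⟨(r : ℝ), fun n => ?_⟩
    apply Real.sSup_le _ hrpos.le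
    rintro ρ ⟨σ, _, h1, h2, rfl⟩
    exact ratio_le h1 h2
  have hvb : Filter.IsBoundedUnder (· ≤ ·) Filter.atTop v := by
    refine Filter.isBoundedUnder_of ⟨(r : ℝ), fun n => ?_⟩
    apply Real.sSup_le _ hrpos.le
    rintro ρ ⟨σ, f', _, h1, h2, _, rfl⟩
    exact ratio_le h1 h2
  have hvalid : ∀ n t, s ≤ t → t ≤ k → ValidSeq k (seqA n s t) := by
    intro n t h1 h2 a ha
    rcases seqA_mem ha with rfl | rfl <;> omega
  have hatm : ∀ n t, s ≤ t → AtMostPerBin k r (seqA n s t) := by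
    intro n t h1
    refine atMost_of_ge hs hk ?_
    intro a ha
    rcases seqA_mem ha with rfl | rfl <;> omega
  apply le_of_forall_pos_sub_le
  intro δ hδ
  -- choose ε with ε r ^ 2 / 2 = δ
  set ε : ℝ := 2 * δ / (r * r) with hε
  have hεpos : 0 < ε := by positivity
  have hεr : ε * r * r = 2 * δ := by rw [hε]; field_simp
  have hev : ∀ᶠ n in Filter.atTop, u n < 1 + α + ε :=
    Filter.eventually_lt_of_limsup_lt (by linarith) hub
  obtain ⟨N, hN⟩ := Filter.eventually_atTop.1 hev
  apply Filter.le_limsup_of_frequently_le _ hvb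
  rw [Filter.frequently_atTop]
  intro M
  set j : ℕ := M + N + 1 with hj
  set n : ℕ := r * j with hn
  have hjn : j ≤ n := by rw [hn]; nlinarith
  refine ⟨2 * n, by omega, ?_⟩
  set σ1 := seqA n s (k - s) with hσ1
  set σ2 := seqA n s s with hσ2
  set f := freq σ1 with hf
  have hfv : ValidPred k f := freq_valid k σ1
  have hcore := core (n := n) hr2 hs hk hfeas hfv
  rw [← hσ1, ← hσ2] at hcore
  have hnpos : (0 : ℝ) < n := by exact_mod_cast (by omega : 0 < n)
  have hjpos : (0 : ℝ) < j := by exact_mod_cast (by omega : 0 < j)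
  -- consistency
  have h1 : (pCost A f σ1 : ℝ) / (OPT k ↑σ1 : ℝ) ≤ u (2 * n) := by
    apply le_csSup
    · refine ⟨(r : ℝ), ?_⟩
      rintro ρ ⟨σ, _, h1, h2, rfl⟩
      exact ratio_le h1 h2
    · exact ⟨σ1, seqA_len _ _ _, hvalid _ _ (by omega) (by omega), hatm _ _ (by omega), rfl⟩
  have h2 := hN (2 * n) (by omega)
  have ho1 : (0 : ℝ) < OPT k ↑σ1 := by
    have := len_le_opt (hvalid n (k - s) (by omega) (by omega)) (hatm n (k - s) (by omega))
    rw [seqA_len] at this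
    have h : 0 < OPT k ↑σ1 := by
      rcases Nat.eq_zero_or_pos (OPT k ↑σ1) with h | h
      · rw [← hσ1, h] at this; omega
      · exact h
    exact_mod_cast h
  have ho2 : (0 : ℝ) < OPT k ↑σ2 := by
    have := len_le_opt (hvalid n s le_rfl (by omega)) (hatm n s le_rfl)
    rw [seqA_len] at this
    have h : 0 < OPT k ↑σ2 := by
      rcases Nat.eq_zero_or_pos (OPT k ↑σ2) with h | h
      · rw [← hσ2, h] at this; omega
      · exact h
    exact_mod_cast h
  have h3 : (pCost A f σ1 : ℝ) ≤ (1 + α + ε) * n := by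
    have h4 := (div_le_iff₀ ho1).1 (h1.trans h2.le)
    have h5 : (OPT k ↑σ1 : ℝ) ≤ n := by exact_mod_cast opt_seqA (by omega)
    exact h4.trans (mul_le_mul_of_nonneg_left h5 (by linarith))
  have h6 : (n : ℝ) + r * n ≤ r * pCost A f σ1 + pCost A f σ2 := by exact_mod_cast hcore
  have h7 : (OPT k ↑σ2 : ℝ) ≤ 2 * j := by exact_mod_cast opt_seqB hk
  have h8 : (1 - c - ε * r) * n ≤ pCost A f σ2 := by
    have := mul_le_mul_of_nonneg_left h3 hrpos.le
    have h9 := mul_le_mul_of_nonneg_right hαr hnpos.le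
    nlinarith
  have h10 : (1 - c) * r / 2 - δ ≤ (pCost A f σ2 : ℝ) / (OPT k ↑σ2 : ℝ) := by
    have h11 : (pCost A f σ2 : ℝ) / (2 * j) ≤ (pCost A f σ2 : ℝ) / (OPT k ↑σ2 : ℝ) :=
      div_le_div_of_nonneg_left (by positivity) ho2 h7
    refine le_trans ?_ h11
    rw [le_div_iff₀ (by positivity)]
    refine le_trans (le_of_eq ?_) h8
    have : (n : ℝ) = r * j := by rw [hn]; push_cast; ring
    rw [this]
    linear_combination (-(j : ℝ)) * hεr * (-1)
  refine h10.trans ?_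
  apply le_csSup
  · refine ⟨(r : ℝ), ?_⟩
    rintro ρ ⟨σ, f', _, h1, h2, _, rfl⟩
    exact ratio_le h1 h2
  · exact ⟨σ2, f, seqA_len _ _ _, hvalid _ _ le_rfl (by omega), hatm _ _ le_rfl, hfv, rfl⟩


end BinPackingWithPredictions
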